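/- Let O ⊆ ℝ^d be open and U ∈ C^∞(O;ℝ). Suppose ΔU ≤ c₁|∇U|² + C₂ on O with c₁ ∈ (0,1), C₂ > 0, let ε ∈ (0, (1−c₁)²/4), and let C_ε ≥ 0 be such that |∇²U(q) y| ≤ ε|∇U(q)|²|y| + C_ε|y| for all q ∈ O, y ∈ ℝ^d. Set ξ_ε = (1 − 4ε/(1−c₁)²)^{−1} max{1, (C_ε + 2C₂ε/(1−c₁))/2}. Then for every φ ∈ C_c^∞(O): ∫_O |∇²φ|_F² e^{−U} dq ≤ ξ_ε ∫_O (φ − Δφ + ∇U·∇φ)² e^{−U} dq. -/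

import Mathlib

open MeasureTheory Set Filter
open scoped RealInnerProductSpace ENNReal

noncomputable section

abbrev E (d : ℕ) := EuclideanSpace ℝ (Fin d)

/-- The Laplacian of a function on Euclidean space, as the trace of its Hessian. -/
def lap {d : ℕ} (f : E d → ℝ) (x : E d) : ℝ :=
  ∑ i, ⟪fderiv ℝ (gradient f) x (EuclideanSpace.single i 1), EuclideanSpace.single i 1⟫

/-- Squared Frobenius norm of the Hessian of `f`. -/
def hessFrobSq {d : ℕ} (f : E d → ℝ) (q : E d) : ℝ :=
  ∑ i, ∑ j, ⟪fderiv ℝ (gradient f) q (EuclideanSpace.single j 1),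
    EuclideanSpace.single i 1⟫ ^ 2

open scoped ContDiff

/-- The `i`-th partial derivative. -/
def pd {d : ℕ} (i : Fin d) (f : E d → ℝ) (x : E d) : ℝ :=
  fderiv ℝ f x (EuclideanSpace.single i 1)

section PartialDerivatives

variable {d : ℕ} {i j : Fin d} {f g : E d → ℝ} {x : E d}

lemma ContDiff.pd (hf : ContDiff ℝ ∞ f) (i : Fin d) : ContDiff ℝ ∞ (pd i f) :=
  (hf.fderiv_right (m := ∞) (by simp)).clm_apply contDiff_const

lemma tsupport_pd_subset (i : Fin d) (f : E d → ℝ) : tsupport (pd i f) ⊆ tsupport f :=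
  tsupport_fderiv_apply_subset ℝ _

lemma pd_of_notMem_tsupport (hx : x ∉ tsupport f) : pd i f x = 0 :=
  image_eq_zero_of_notMem_tsupport fun h => hx (tsupport_pd_subset i f h)

lemma pd_pd_of_notMem_tsupport (hx : x ∉ tsupport f) : pd i (pd j f) x = 0 :=
  pd_of_notMem_tsupport fun h => hx (tsupport_pd_subset j f h)

lemma pd_mul (hf : ContDiff ℝ ∞ f) (hg : ContDiff ℝ ∞ g) :
    pd i (fun y => f y * g y) x = pd i f x * g x + f x * pd i g x := by
  simp only [pd]
  rw [fderiv_fun_mul (hf.differentiable (by simp) x) (hg.differentiable (by simp) x)]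
  simp
  ring

lemma pd_sub (hf : ContDiff ℝ ∞ f) (hg : ContDiff ℝ ∞ g) :
    pd i (fun y => f y - g y) x = pd i f x - pd i g x := by
  simp only [pd]
  rw [fderiv_fun_sub (hf.differentiable (by simp) x) (hg.differentiable (by simp) x)]
  simp

lemma pd_exp_neg (hf : ContDiff ℝ ∞ f) :
    pd i (fun y => Real.exp (-f y)) x = -pd i f x * Real.exp (-f x) := by
  have h := ((hf.differentiable (by simp) x).hasFDerivAt.neg.exp).fderiv
  simp only [Pi.neg_apply] at h
  simp only [pd, h]
  simp
  ring

lemma pd_comm (hf : ContDiff ℝ ∞ f) (i j : Fin d) : pd i (pd j f) = pd j (pd i f) := by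
  have key : ∀ (i j : Fin d) (y : E d), pd i (pd j f) y =
      fderiv ℝ (fderiv ℝ f) y (EuclideanSpace.single i 1) (EuclideanSpace.single j 1) := by
    intro i j y
    have h : DifferentiableAt ℝ (fderiv ℝ f) y :=
      (hf.fderiv_right (m := ∞) (by simp)).differentiable (by simp) y
    change fderiv ℝ (fun z => fderiv ℝ f z (EuclideanSpace.single j 1)) y _ = _
    rw [fderiv_clm_apply h (differentiableAt_const _)]
    simp
  funext y
  rw [key, key]
  exact (hf.contDiffAt.isSymmSndFDerivAt (by
    simpa using WithTop.coe_le_coe.2 (le_top : (2 : ℕ∞) ≤ ⊤))).eq _ _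

lemma gradient_apply_eq_pd (f : E d → ℝ) (x : E d) (i : Fin d) : gradient f x i = pd i f x := by
  have h : ⟪gradient f x, EuclideanSpace.single i (1 : ℝ)⟫ = pd i f x := by
    simp only [gradient, InnerProductSpace.toDual_symm_apply, pd]
  rw [← h, EuclideanSpace.inner_single_right]
  simp

lemma inner_gradient_eq_sum (f g : E d → ℝ) (x : E d) :
    ⟪gradient f x, gradient g x⟫ = ∑ i, pd i f x * pd i g x := by
  simp only [PiLp.inner_apply, gradient_apply_eq_pd]
  simp [mul_comm]

lemma norm_gradient_sq (f : E d → ℝ) (x : E d) : ‖gradient f x‖ ^ 2 = ∑ i, pd i f x ^ 2 := by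
  simp [EuclideanSpace.real_norm_sq_eq, gradient_apply_eq_pd]

lemma differentiable_gradient (hf : ContDiff ℝ ∞ f) : Differentiable ℝ (gradient f) :=
  (InnerProductSpace.toDual ℝ (E d)).symm.toContinuousLinearEquiv.differentiable.comp
    ((hf.fderiv_right (m := ∞) (by simp)).differentiable (by simp))

lemma fderiv_gradient_apply (hf : ContDiff ℝ ∞ f) (x y : E d) (i : Fin d) :
    fderiv ℝ (gradient f) x y i = fderiv ℝ (pd i f) x y := by
  have h : pd i f = fun z => EuclideanSpace.proj (𝕜 := ℝ) i (gradient f z) := by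
    funext z
    simp [gradient_apply_eq_pd]
  rw [h]
  have h' := ((EuclideanSpace.proj (𝕜 := ℝ) i).hasFDerivAt.comp x
    (differentiable_gradient hf x).hasFDerivAt).fderiv
  rw [Function.comp_def] at h'
  rw [h']
  simp

lemma inner_fderiv_gradient_single (hf : ContDiff ℝ ∞ f) (x : E d) (i j : Fin d) :
    ⟪fderiv ℝ (gradient f) x (EuclideanSpace.single j 1), EuclideanSpace.single i 1⟫ =
      pd j (pd i f) x := by
  simp [EuclideanSpace.inner_single_right, fderiv_gradient_apply hf, pd]

lemma lap_eq_sum_pd (hf : ContDiff ℝ ∞ f) (x : E d) : lap f x = ∑ i, pd i (pd i f) x := by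
  simp only [lap, inner_fderiv_gradient_single hf]

lemma hessFrobSq_eq_sum_pd (hf : ContDiff ℝ ∞ f) (x : E d) :
    hessFrobSq f x = ∑ i, ∑ j, pd j (pd i f) x ^ 2 := by
  simp only [hessFrobSq, inner_fderiv_gradient_single hf]

lemma clm_apply_eq_sum (L : E d →L[ℝ] ℝ) (y : E d) :
    L y = ∑ j, y j * L (EuclideanSpace.single j 1) := by
  conv_lhs => rw [← (EuclideanSpace.basisFun (Fin d) ℝ).sum_repr y]
  simp

lemma inner_fderiv_gradient (hf : ContDiff ℝ ∞ f) (x y : E d) :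
    ⟪fderiv ℝ (gradient f) x y, y⟫ = ∑ i, ∑ j, pd i (pd j f) x * y i * y j := by
  rw [Finset.sum_comm]
  simp only [PiLp.inner_apply, fderiv_gradient_apply hf, clm_apply_eq_sum _ y]
  refine Finset.sum_congr rfl fun i _ => ?_
  simp only [RCLike.inner_apply, conj_trivial, Finset.mul_sum]
  refine Finset.sum_congr rfl fun j _ => ?_
  simp only [pd]
  ring

end PartialDerivatives

/-- The `i`-th partial derivative of `F e^{-U}`, divided by `e^{-U}`. -/
def wdiv {d : ℕ} (U : E d → ℝ) (i : Fin d) (F : E d → ℝ) (x : E d) : ℝ :=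
  pd i F x - F x * pd i U x

/-- The overdamped Langevin generator `Δ - ∇U·∇`. -/
def langevin {d : ℕ} (U f : E d → ℝ) (x : E d) : ℝ :=
  ∑ i, (pd i (pd i f) x - pd i U x * pd i f x)

/-- `F` is integrable with vanishing integral for the weight `e^{-U}`. -/
def WeightedNull {d : ℕ} (U F : E d → ℝ) : Prop :=
  Integrable (fun x => F x * Real.exp (-U x)) ∧ ∫ x, F x * Real.exp (-U x) = 0

namespace WeightedNull

variable {d : ℕ} {U F G : E d → ℝ}

lemma add (hF : WeightedNull U F) (hG : WeightedNull U G) :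
    WeightedNull U (fun x => F x + G x) := by
  simp only [WeightedNull, add_mul]
  exact ⟨hF.1.add hG.1, by rw [integral_add hF.1 hG.1, hF.2, hG.2, add_zero]⟩

lemma const_mul (hF : WeightedNull U F) (c : ℝ) : WeightedNull U (fun x => c * F x) := by
  simp only [WeightedNull, mul_assoc]
  exact ⟨hF.1.const_mul c, by rw [integral_const_mul, hF.2, mul_zero]⟩

lemma sum {ι : Type*} {s : Finset ι} {F : ι → E d → ℝ} (hF : ∀ i ∈ s, WeightedNull U (F i)) :
    WeightedNull U (fun x => ∑ i ∈ s, F i x) := by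
  simp only [WeightedNull, Finset.sum_mul]
  refine ⟨integrable_finsetSum _ fun i hi => (hF i hi).1, ?_⟩
  rw [integral_finsetSum _ fun i hi => (hF i hi).1]
  exact Finset.sum_eq_zero fun i hi => (hF i hi).2

/-- The divergence theorem for the weight `e^{-U}`. -/
lemma wdiv (hU : ContDiff ℝ ∞ U) (hF : ContDiff ℝ ∞ F) (hFc : HasCompactSupport F)
    (i : Fin d) : WeightedNull U (_root_.wdiv U i F) := by
  have hw : ContDiff ℝ ∞ (fun x => Real.exp (-U x)) := hU.neg.exp
  have hsmooth : ContDiff ℝ ∞ (fun x => F x * Real.exp (-U x)) := hF.mul hw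
  have hsupp : HasCompactSupport (fun x => F x * Real.exp (-U x)) := hFc.mul_right
  have hpd : (fun x => _root_.wdiv U i F x * Real.exp (-U x)) =
      pd i (fun x => F x * Real.exp (-U x)) := by
    funext x
    rw [pd_mul hF hw, pd_exp_neg hU, _root_.wdiv]
    ring
  have hint : Integrable (pd i (fun x => F x * Real.exp (-U x))) :=
    (hsmooth.pd i).continuous.integrable_of_hasCompactSupport (hsupp.fderiv_apply (𝕜 := ℝ) _)
  rw [WeightedNull, hpd]
  refine ⟨hint, ?_⟩
  have h := integral_mul_fderiv_eq_neg_fderiv_mul_of_integrable (μ := (volume : Measure (E d)))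
    (f := fun _ => (1 : ℝ)) (g := fun x => F x * Real.exp (-U x))
    (v := EuclideanSpace.single i 1) (by simp) (by simp only [one_mul]; exact hint)
    (by simpa using hsmooth.continuous.integrable_of_hasCompactSupport hsupp)
    (fun _ _ => differentiableAt_const _) (fun x _ => hsmooth.differentiable (by simp) x)
  simp only [one_mul, fderiv_fun_const, Pi.zero_apply, zero_apply, zero_mul,
    integral_zero, neg_zero] at h
  exact h

end WeightedNull

section Identities

variable {d : ℕ} {U φ : E d → ℝ}

lemma mul_langevin_add_sum_sq (hφ : ContDiff ℝ ∞ φ) (x : E d) :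
    φ x * langevin U φ x + ∑ i, pd i φ x ^ 2 =
      ∑ i, wdiv U i (fun y => φ y * pd i φ y) x := by
  simp only [langevin, wdiv, Finset.mul_sum, ← Finset.sum_add_distrib]
  refine Finset.sum_congr rfl fun i _ => ?_
  rw [pd_mul hφ (hφ.pd i)]
  ring

/-- Bochner's identity for the Langevin generator, up to divergence terms. -/
lemma langevin_sq (hU : ContDiff ℝ ∞ U) (hφ : ContDiff ℝ ∞ φ) (x : E d) :
    langevin U φ x ^ 2 =
      ∑ i, ∑ j, pd j (pd i φ) x ^ 2 + ∑ i, ∑ j, pd i (pd j U) x * pd i φ x * pd j φ x +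
      ∑ i, ∑ j, (wdiv U i
          (fun y => pd i φ y * (pd j (pd j φ) y - pd j U y * pd j φ y)) x +
        (-1) * wdiv U j (fun y => pd i φ y * pd j (pd i φ) y) x) := by
  simp only [langevin, sq (∑ i, _), Finset.sum_mul_sum, ← Finset.sum_add_distrib]
  refine Finset.sum_congr rfl fun i _ => Finset.sum_congr rfl fun j _ => ?_
  have hfj := hφ.pd j
  have hi := hφ.pd i
  rw [wdiv, wdiv, pd_mul hi ((hfj.pd j).sub ((hU.pd j).mul hfj)), pd_mul hi (hi.pd j),
    pd_sub (hfj.pd j) ((hU.pd j).mul hfj), pd_mul (hU.pd j) hfj, pd_comm hfj i j,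
    pd_comm hφ i j]
  ring

lemma sum_wdiv_sq_mul (hU : ContDiff ℝ ∞ U) (hφ : ContDiff ℝ ∞ φ) (x : E d) :
    ∑ i, ∑ j, wdiv U i (fun y => pd j φ y * pd j φ y * pd i U y) x =
      ∑ i, ∑ j, 2 * (pd j φ x * pd i U x) * pd i (pd j φ) x +
      (∑ j, pd j φ x ^ 2) * ∑ i, pd i (pd i U) x -
      (∑ j, pd j φ x ^ 2) * ∑ i, pd i U x ^ 2 := by
  simp only [mul_comm (∑ j, pd j φ x ^ 2), Finset.sum_mul_sum, ← Finset.sum_add_distrib,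
    ← Finset.sum_sub_distrib]
  refine Finset.sum_congr rfl fun i _ => Finset.sum_congr rfl fun j _ => ?_
  have hj := hφ.pd j
  rw [wdiv, pd_mul (hj.mul hj) (hU.pd i), pd_mul hj hj]
  ring

lemma sum_two_mul_le (hφ : ContDiff ℝ ∞ φ) {a : ℝ} (ha : 0 < a) (x : E d) :
    ∑ i, ∑ j, 2 * (pd j φ x * pd i U x) * pd i (pd j φ) x ≤
      a / 2 * ((∑ j, pd j φ x ^ 2) * ∑ i, pd i U x ^ 2) +
        2 / a * ∑ i, ∑ j, pd j (pd i φ) x ^ 2 := by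
  rw [mul_comm (∑ j, pd j φ x ^ 2), Finset.sum_mul_sum]
  simp only [Finset.mul_sum, ← Finset.sum_add_distrib]
  refine Finset.sum_le_sum fun i _ => Finset.sum_le_sum fun j _ => ?_
  rw [pd_comm hφ i j]
  have h := mul_nonneg (by positivity : 0 ≤ 1 / (2 * a))
    (sq_nonneg (a * (pd j φ x * pd i U x) - 2 * pd j (pd i φ) x))
  have e : 1 / (2 * a) * (a * (pd j φ x * pd i U x) - 2 * pd j (pd i φ) x) ^ 2 =
      a / 2 * (pd i U x ^ 2 * pd j φ x ^ 2) + 2 / a * pd j (pd i φ) x ^ 2 -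
        2 * (pd j φ x * pd i U x) * pd j (pd i φ) x := by
    field_simp
    ring
  linarith

end Identities

lemma mul_le_of_villani_bounds {a ε Cε C₂ S G A K l f L D₀ D₁ D₂ : ℝ} (ha : 0 < a) (hε : 0 < ε)
    (hG : 0 ≤ G) (h0 : f * l + G = D₀) (h1 : l ^ 2 = S + K + D₁)
    (h2 : D₂ ≤ a / 2 * A + 2 / a * S + L - A)
    (hL : L ≤ (1 - a) * A + C₂ * G) (hK : -(ε * A + Cε * G) ≤ K) :
    (1 - 4 * ε / a ^ 2) * S ≤
      max 1 ((Cε + 2 * C₂ * ε / a) / 2) * (f - l) ^ 2 +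
        (2 * max 1 ((Cε + 2 * C₂ * ε / a) / 2) * D₀ + ((-1) * D₁ + -(2 * ε / a) * D₂)) := by
  set M := max 1 ((Cε + 2 * C₂ * ε / a) / 2)
  have hM1 : 1 ≤ M := le_max_left _ _
  have hMκ : (Cε + 2 * C₂ * ε / a) / 2 ≤ M := le_max_right _ _
  have hA : ε * A ≤ 4 * ε / a ^ 2 * S + 2 * C₂ * ε / a * G - 2 * ε / a * D₂ := by
    have h := mul_le_mul_of_nonneg_left (h2.trans (sub_le_sub_right (add_le_add_right hL _) A))
      (by positivity : 0 ≤ 2 * ε / a)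
    have e : 2 * ε / a * (a / 2 * A + 2 / a * S + ((1 - a) * A + C₂ * G) - A) =
        4 * ε / a ^ 2 * S + 2 * C₂ * ε / a * G - ε * A := by
      field_simp
      ring
    linarith
  have hQ : M * (f - l) ^ 2 + 2 * M * D₀ = M * f ^ 2 + M * l ^ 2 + 2 * M * G := by
    rw [← h0]
    ring
  have hf : 0 ≤ M * f ^ 2 := by positivity
  have hl : l ^ 2 ≤ M * l ^ 2 := le_mul_of_one_le_left (sq_nonneg l) hM1
  have hκ := mul_le_mul_of_nonneg_right hMκ hG
  linarith

theorem integral_hess_sq_le {d : ℕ} {U φ : E d → ℝ} (hU : ContDiff ℝ ∞ U)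
    (hφ : ContDiff ℝ ∞ φ) (hφc : HasCompactSupport φ) {a C₂ ε Cε : ℝ} (ha : 0 < a) (hε : 0 < ε)
    (hlap : ∀ x ∈ tsupport φ,
      ∑ i, pd i (pd i U) x ≤ (1 - a) * ∑ i, pd i U x ^ 2 + C₂)
    (hhess : ∀ x ∈ tsupport φ,
      -((ε * ∑ i, pd i U x ^ 2 + Cε) * ∑ i, pd i φ x ^ 2) ≤
        ∑ i, ∑ j, pd i (pd j U) x * pd i φ x * pd j φ x) :
    (1 - 4 * ε / a ^ 2) * ∫ x, (∑ i, ∑ j, pd j (pd i φ) x ^ 2) * Real.exp (-U x) ≤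
      max 1 ((Cε + 2 * C₂ * ε / a) / 2) *
        ∫ x, (φ x - langevin U φ x) ^ 2 * Real.exp (-U x) := by
  set M := max 1 ((Cε + 2 * C₂ * ε / a) / 2)
  have hpdc : ∀ i, HasCompactSupport (pd i φ) := fun i => hφc.fderiv_apply (𝕜 := ℝ) _
  have hN : WeightedNull U (fun x =>
      2 * M * ∑ i, wdiv U i (fun y => φ y * pd i φ y) x +
        ((-1) * ∑ i, ∑ j, (wdiv U i
            (fun y => pd i φ y * (pd j (pd j φ) y - pd j U y * pd j φ y)) x +
          (-1) * wdiv U j (fun y => pd i φ y * pd j (pd i φ) y) x) +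
        -(2 * ε / a) * ∑ i, ∑ j, wdiv U i (fun y => pd j φ y * pd j φ y * pd i U y) x)) := by
    refine .add (.const_mul (.sum fun i _ => ?_) _) (.add
      (.const_mul (.sum fun i _ => .sum fun j _ => .add ?_ (.const_mul ?_ _)) _)
      (.const_mul (.sum fun i _ => .sum fun j _ => ?_) _))
    · exact .wdiv hU (hφ.mul (hφ.pd i)) hφc.mul_right i
    · exact .wdiv hU ((hφ.pd i).mul (((hφ.pd j).pd j).sub ((hU.pd j).mul (hφ.pd j))))
        (hpdc i).mul_right i
    · exact .wdiv hU ((hφ.pd i).mul ((hφ.pd i).pd j)) (hpdc i).mul_right j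
    · exact .wdiv hU (((hφ.pd j).mul (hφ.pd j)).mul (hU.pd i)) (hpdc j).mul_right.mul_right i
  have hw : Continuous fun x => Real.exp (-U x) := hU.neg.exp.continuous
  have hS : Integrable fun x => (∑ i, ∑ j, pd j (pd i φ) x ^ 2) * Real.exp (-U x) := by
    refine Continuous.integrable_of_hasCompactSupport (.mul ?_ hw) (.intro hφc fun x hx => ?_)
    · exact continuous_finsetSum _ fun i _ => continuous_finsetSum _ fun j _ =>
        ((hφ.pd i).pd j).continuous.pow 2
    · simp [pd_pd_of_notMem_tsupport hx]
  have hQ : Integrable fun x => (φ x - langevin U φ x) ^ 2 * Real.exp (-U x) := by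
    refine Continuous.integrable_of_hasCompactSupport (.mul (.pow (.sub hφ.continuous ?_) 2) hw)
      (.intro hφc fun x hx => ?_)
    · exact continuous_finsetSum _ fun i _ => ((hφ.pd i).pd i).continuous.sub
        ((hU.pd i).continuous.mul (hφ.pd i).continuous)
    · simp [langevin, pd_pd_of_notMem_tsupport hx, pd_of_notMem_tsupport hx,
        image_eq_zero_of_notMem_tsupport hx]
  rw [← integral_const_mul, ← integral_const_mul, ← add_zero (∫ x, M * _), ← hN.2,
    ← integral_add (hQ.const_mul M) hN.1]
  refine integral_mono (hS.const_mul _) ((hQ.const_mul M).add hN.1) fun x => ?_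
  simp only [← mul_assoc, ← add_mul]
  refine mul_le_mul_of_nonneg_right ?_ (Real.exp_pos _).le
  have hG : 0 ≤ ∑ i, pd i φ x ^ 2 := Finset.sum_nonneg fun i _ => sq_nonneg _
  have hD₂ := sum_wdiv_sq_mul hU hφ x
  have hY := sum_two_mul_le (U := U) hφ ha x
  refine mul_le_of_villani_bounds (Cε := Cε) (C₂ := C₂)
    (A := (∑ j, pd j φ x ^ 2) * ∑ i, pd i U x ^ 2)
    (L := (∑ j, pd j φ x ^ 2) * ∑ i, pd i (pd i U) x) ha hε hG
    (mul_langevin_add_sum_sq hφ x) (langevin_sq hU hφ x) ?_ ?_ ?_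
  · linarith
  · by_cases hx : x ∈ tsupport φ
    · linarith [mul_le_mul_of_nonneg_left (hlap x hx) hG]
    · simp [pd_of_notMem_tsupport hx]
  · by_cases hx : x ∈ tsupport φ
    · linarith [hhess x hx]
    · simp [pd_of_notMem_tsupport hx]

/-- A function smooth on an open set agrees with a globally smooth one near any compact subset. -/
lemma exists_contDiff_eventuallyEq {d : ℕ} {O K : Set (E d)} (hO : IsOpen O) {U : E d → ℝ}
    (hU : ContDiffOn ℝ ∞ U O) (hK : IsCompact K) (hKO : K ⊆ O) :
    ∃ V : E d → ℝ, ContDiff ℝ ∞ V ∧ ∀ x ∈ K, V =ᶠ[nhds x] U := by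
  obtain ⟨t, ht, hKt, htO⟩ := exists_compact_between hK hO hKO
  obtain ⟨χ, hχ1, hχ0, -⟩ := exists_contMDiffMap_one_nhds_of_subset_interior (n := (⊤ : ℕ∞))
    (modelWithCornersSelf ℝ (E d)) hK.isClosed hKt
  refine ⟨fun x => χ x * U x, contDiff_iff_contDiffAt.2 fun x => ?_, fun x hx => ?_⟩
  · by_cases hx : x ∈ O
    · exact χ.contMDiff.contDiff.contDiffAt.mul (hU.contDiffAt (hO.mem_nhds hx))
    · refine (contDiffAt_const (c := (0 : ℝ))).congr_of_eventuallyEq ?_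
      filter_upwards [ht.isClosed.isOpen_compl.mem_nhds fun h => hx (htO h)] with y hy
      simp [hχ0 y hy]
  · filter_upwards [Filter.Eventually.filter_mono (nhds_le_nhdsSet hx) hχ1] with y hy
    simp [hy]

theorem stmt14 {d : ℕ} (O : Set (E d)) (hO : IsOpen O)
    (U : E d → ℝ) (hU : ContDiffOn ℝ (⊤ : ℕ∞) U O)
    (c₁ C₂ : ℝ) (hc₁ : c₁ ∈ Set.Ioo (0 : ℝ) 1) (hC₂ : 0 < C₂)
    (hlap : ∀ q ∈ O, lap U q ≤ c₁ * ‖gradient U q‖ ^ 2 + C₂)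
    (ε Cε : ℝ) (hε : ε ∈ Set.Ioo (0 : ℝ) ((1 - c₁) ^ 2 / 4)) (hCε : 0 ≤ Cε)
    (hhess : ∀ q ∈ O, ∀ y : E d,
      ‖fderiv ℝ (gradient U) q y‖ ≤ ε * ‖gradient U q‖ ^ 2 * ‖y‖ + Cε * ‖y‖)
    (φ : E d → ℝ) (hφ : ContDiff ℝ (⊤ : ℕ∞) φ) (hφc : HasCompactSupport φ)
    (hφsupp : tsupport φ ⊆ O) :
    ∫ q in O, hessFrobSq φ q * Real.exp (-U q) ≤
      (1 - 4 * ε / (1 - c₁) ^ 2)⁻¹ * max 1 ((Cε + 2 * C₂ * ε / (1 - c₁)) / 2) *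
        ∫ q in O, (φ q - lap φ q + ⟪gradient U q, gradient φ q⟫) ^ 2 * Real.exp (-U q) := by
  obtain ⟨V, hV, hVU⟩ := exists_contDiff_eventuallyEq hO hU hφc.isCompact hφsupp
  have hgrad : ∀ x ∈ tsupport φ, gradient V =ᶠ[nhds x] gradient U := fun x hx =>
    (hVU x hx).fderiv.mono fun y hy => by rw [gradient, gradient, hy]
  have ha : 0 < 1 - c₁ := sub_pos.2 hc₁.2
  have hmain := integral_hess_sq_le (C₂ := C₂) (Cε := Cε) hV hφ hφc ha hε.1
    (fun x hx => by
      rw [← lap_eq_sum_pd hV, ← norm_gradient_sq, sub_sub_cancel, lap, (hgrad x hx).fderiv_eq,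
        (hgrad x hx).eq_of_nhds]
      exact hlap x (hφsupp hx))
    (fun x hx => by
      have h := hhess x (hφsupp hx) (gradient φ x)
      have h' := abs_real_inner_le_norm (fderiv ℝ (gradient U) x (gradient φ x)) (gradient φ x)
      have h'' := mul_le_mul_of_nonneg_right h (norm_nonneg (gradient φ x))
      have e := inner_fderiv_gradient hV x (gradient φ x)
      simp only [gradient_apply_eq_pd] at e
      rw [← e, ← norm_gradient_sq, ← norm_gradient_sq, (hgrad x hx).fderiv_eq,
        (hgrad x hx).eq_of_nhds]
      linarith [neg_abs_le ⟪fderiv ℝ (gradient U) x (gradient φ x), gradient φ x⟫])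
  have hL : ∀ x, lap φ x - ⟪gradient V x, gradient φ x⟫ = langevin V φ x := fun x => by
    rw [lap_eq_sum_pd hφ, inner_gradient_eq_sum, langevin, Finset.sum_sub_distrib]
  have hS : ∫ q in O, hessFrobSq φ q * Real.exp (-U q) =
      ∫ x, (∑ i, ∑ j, pd j (pd i φ) x ^ 2) * Real.exp (-V x) := by
    rw [setIntegral_eq_integral_of_forall_compl_eq_zero]
    · refine integral_congr_ae (.of_forall fun x => ?_)
      by_cases hx : x ∈ tsupport φ
      · simp only [hessFrobSq_eq_sum_pd hφ, (hVU x hx).eq_of_nhds]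
      · simp [hessFrobSq_eq_sum_pd hφ, pd_pd_of_notMem_tsupport hx]
    · intro x hx
      simp [hessFrobSq_eq_sum_pd hφ, pd_pd_of_notMem_tsupport fun h => hx (hφsupp h)]
  have hQ : ∫ q in O, (φ q - lap φ q + ⟪gradient U q, gradient φ q⟫) ^ 2 * Real.exp (-U q) =
      ∫ x, (φ x - langevin V φ x) ^ 2 * Real.exp (-V x) := by
    have hzero : ∀ x ∉ tsupport φ, φ x = 0 ∧ lap φ x = 0 ∧ gradient φ x = 0 := fun x hx =>
      ⟨image_eq_zero_of_notMem_tsupport hx,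
        by simp [lap_eq_sum_pd hφ, pd_pd_of_notMem_tsupport hx],
        by simp [gradient, fderiv_of_notMem_tsupport ℝ hx]⟩
    rw [setIntegral_eq_integral_of_forall_compl_eq_zero]
    · refine integral_congr_ae (.of_forall fun x => ?_)
      simp only [← hL]
      by_cases hx : x ∈ tsupport φ
      · rw [(hVU x hx).eq_of_nhds, (hgrad x hx).eq_of_nhds, sub_sub_eq_add_sub,
          add_sub_right_comm]
      · simp [hzero x hx]
    · intro x hx
      simp [hzero x fun h => hx (hφsupp h)]
  have hθ : 0 < 1 - 4 * ε / (1 - c₁) ^ 2 := by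
    rw [sub_pos, div_lt_one (by positivity)]
    linarith [hε.2]
  rw [hS, hQ, mul_assoc, inv_mul_eq_div, le_div_iff₀' hθ]
  exact hmain
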